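/- arXiv:2502.05862 — 2 statements merged into one kernel-verified Lean document; each statement's English description precedes it below -/
import Mathlib

section
/- Let ρ be a critical radius function on ℝ^n, θ ≥ 0, 0 ≤ α < n, 1 ≤ p < ∞ and p ≤ q < ∞, and let μ, ν be weights. If there is a constant c > 0 such that ‖M_α^{ρ,θ}(χ_E)‖_{L^{q,∞}(ν)} ≤ c·μ(E)^{1/p} for every measurable set E ⊆ ℝ^n, then ‖μ,ν‖_{A_{p,q,α}^{ρ,θ,R}} ≤ c; in particular ‖μ,ν‖_{A_{p,q,α}^{ρ,θ,R}} < ∞. -/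
open MeasureTheory ENNReal Set
noncomputable section

/-- `ℝ^n` with the Euclidean norm. -/
abbrev Rn (n : ℕ) := EuclideanSpace ℝ (Fin n)

/-- The cube of center `c` and side length `r`. -/
def cube {n : ℕ} (c : Rn n) (r : ℝ) : Set (Rn n) := {y | ∀ i, |y i - c i| ≤ r / 2}

/-- `ψ_θ(Q) = (1 + r_Q/ρ(x_Q))^θ` for the cube `Q` of center `c` and side length `r`. -/
def psi {n : ℕ} (ρ : Rn n → ℝ) (θ : ℝ) (c : Rn n) (r : ℝ) : ℝ := (1 + r / ρ c) ^ θ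

/-- `ρ` is a critical radius function with constants `C₀, N₀`. -/
def IsCriticalRadiusWith {n : ℕ} (ρ : Rn n → ℝ) (C₀ N₀ : ℝ) : Prop :=
  0 < C₀ ∧ 0 < N₀ ∧ (∀ x, 0 < ρ x) ∧ ∀ x y : Rn n,
    C₀⁻¹ * ρ x * (1 + ‖x - y‖ / ρ x) ^ (-N₀) ≤ ρ y ∧
    ρ y ≤ C₀ * ρ x * (1 + ‖x - y‖ / ρ x) ^ (N₀ / (N₀ + 1))

/-- `ρ` is a critical radius function. -/
def IsCriticalRadius {n : ℕ} (ρ : Rn n → ℝ) : Prop := ∃ C₀ N₀, IsCriticalRadiusWith ρ C₀ N₀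

/-- A weight: locally integrable and a.e. positive. -/
def IsWeight {n : ℕ} (w : Rn n → ℝ) : Prop :=
  LocallyIntegrable w (volume : Measure (Rn n)) ∧ ∀ᵐ x : Rn n, 0 < w x

/-- `w(S) = ∫_S w`. -/
def wMeas {n : ℕ} (w : Rn n → ℝ) (S : Set (Rn n)) : ℝ≥0∞ :=
  ∫⁻ x in S, ENNReal.ofReal (w x)

/-- Fractional maximal operator `M_α^{ρ,θ}` associated with the critical radius function `ρ`. -/
def fracMax (n : ℕ) (ρ : Rn n → ℝ) (θ α : ℝ) (f : Rn n → ℝ) (x : Rn n) : ℝ≥0∞ :=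
  ⨆ (c : Rn n) (r : ℝ) (_ : 0 < r) (_ : x ∈ cube c r),
    ENNReal.ofReal ((psi ρ θ c r * r ^ n) ^ (α / n - 1)) *
      ∫⁻ y in cube c r, ENNReal.ofReal |f y|

/-- The Lorentz `L^{p,1}(w)` norm. -/
def lorentzP1 {n : ℕ} (p : ℝ) (w : Rn n → ℝ) (f : Rn n → ℝ) : ℝ≥0∞ :=
  ENNReal.ofReal p * ∫⁻ y in Ioi (0 : ℝ), (wMeas w {x | y < |f x|}) ^ (1 / p)

/-- The weak `L^{q,∞}(w)` quasi-norm of an `ℝ≥0∞`-valued function. -/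
def weakNormE {n : ℕ} (q : ℝ) (w : Rn n → ℝ) (F : Rn n → ℝ≥0∞) : ℝ≥0∞ :=
  ⨆ (l : ℝ) (_ : 0 < l), ENNReal.ofReal l * (wMeas w {x | ENNReal.ofReal l < F x}) ^ (1 / q)

/-- The weak `L^{q,∞}(w)` quasi-norm of a real function, with `q = ∞` allowed
(in which case it is the `w`-essential supremum). -/
def weakNormR {n : ℕ} (q : ℝ≥0∞) (w : Rn n → ℝ) (f : Rn n → ℝ) : ℝ≥0∞ :=
  if q = ∞ then
    essSup (fun x => ENNReal.ofReal |f x|)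
      ((volume : Measure (Rn n)).withDensity fun x => ENNReal.ofReal (w x))
  else ⨆ (l : ℝ) (_ : 0 < l), ENNReal.ofReal l * (wMeas w {x | l < |f x|}) ^ (1 / q.toReal)

/-- The conjugate exponent `p' = p/(p-1)` (with `1' = ∞`), as an extended real number. -/
def conjE (p : ℝ) : ℝ≥0∞ := if p = 1 then ∞ else ENNReal.ofReal (p / (p - 1))

/-- The constant `[μ,ν]_{A_{p,q,α}^{ρ,θ,R}}`. -/
def ApqR {n : ℕ} (ρ : Rn n → ℝ) (θ α p q : ℝ) (μ ν : Rn n → ℝ) : ℝ≥0∞ :=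
  ⨆ (c : Rn n) (r : ℝ) (_ : 0 < r),
    (wMeas ν (cube c r)) ^ (1 / q) *
      weakNormR (conjE p) μ ((cube c r).indicator fun x => (μ x)⁻¹) *
      ENNReal.ofReal ((r ^ n * psi ρ θ c r) ^ (α / n - 1))

/-- The constant `‖μ,ν‖_{A_{p,q,α}^{ρ,θ,R}}`. -/
def normApqR {n : ℕ} (ρ : Rn n → ℝ) (θ α p q : ℝ) (μ ν : Rn n → ℝ) : ℝ≥0∞ :=
  ⨆ (c : Rn n) (r : ℝ) (_ : 0 < r),
    (wMeas ν (cube c r)) ^ (1 / q) *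
      ⨆ (P : Set (Rn n)) (_ : MeasurableSet P) (_ : 0 < wMeas μ P) (_ : wMeas μ P ≠ ∞),
        volume (P ∩ cube c r) * ENNReal.ofReal ((r ^ n * psi ρ θ c r) ^ (α / n - 1)) *
          (wMeas μ P) ^ (-(1 / p))

/-- The constant `[w]_{A_p^{ρ,σ}}` (for `1 < p < ∞`). -/
def ApC {n : ℕ} (ρ : Rn n → ℝ) (σ p : ℝ) (w : Rn n → ℝ) : ℝ≥0∞ :=
  ⨆ (c : Rn n) (r : ℝ) (_ : 0 < r),
    (ENNReal.ofReal (psi ρ σ c r))⁻¹ *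
      ((ENNReal.ofReal (r ^ n))⁻¹ * wMeas w (cube c r)) *
      ((ENNReal.ofReal (r ^ n))⁻¹ *
        ∫⁻ y in cube c r, ENNReal.ofReal (w y ^ (1 - p / (p - 1)))) ^ (p - 1)
/-- The heat semigroup `e^{tΔ}` on `ℝ^n`. -/
def heatSg (n : ℕ) (t : ℝ) (g : Rn n → ℝ) (x : Rn n) : ℝ :=
  ∫ y : Rn n, (4 * Real.pi * t) ^ (-(n : ℝ) / 2) * Real.exp (-‖x - y‖ ^ 2 / (4 * t)) * g y

/-- The `ϱ`-variation operator of the classical heat semigroup. -/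
def varHeat (n : ℕ) (ϱ : ℝ) (g : Rn n → ℝ) (x : Rn n) : ℝ≥0∞ :=
  ⨆ (t : ℕ → ℝ) (_ : StrictAnti t) (_ : ∀ j, 0 < t j)
      (_ : Filter.Tendsto t Filter.atTop (nhds 0)),
    (∑' j : ℕ, ENNReal.ofReal (|heatSg n (t j) g x - heatSg n (t (j + 1)) g x| ^ ϱ)) ^ (1 / ϱ)

/-- Muckenhoupt `A₁`. -/
def IsA1 {n : ℕ} (w : Rn n → ℝ) : Prop :=
  ∃ C > (0 : ℝ), ∀ (c : Rn n) (r : ℝ), 0 < r →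
    wMeas w (cube c r) ≤ ENNReal.ofReal C * ENNReal.ofReal (r ^ n) *
      essInf (fun x => ENNReal.ofReal (w x)) (volume.restrict (cube c r))

/-- Muckenhoupt `A_p`, `1 < p < ∞`. -/
def IsAp {n : ℕ} (p : ℝ) (w : Rn n → ℝ) : Prop :=
  ∃ C > (0 : ℝ), ∀ (c : Rn n) (r : ℝ), 0 < r →
    wMeas w (cube c r) *
      (∫⁻ y in cube c r, ENNReal.ofReal (w y ^ (1 - p / (p - 1)))) ^ (p - 1) ≤
      ENNReal.ofReal C * (ENNReal.ofReal (r ^ n)) ^ p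

/-- Muckenhoupt `A_∞ = ∪_{p ≥ 1} A_p`. -/
def IsAinfty {n : ℕ} (w : Rn n → ℝ) : Prop := IsA1 w ∨ ∃ p > (1 : ℝ), IsAp p w

/-- The class `A₁^{ρ,loc}`, with the `A₁` condition over balls `B(x,r)`, `r ≤ ρ(x)`. -/
def IsA1loc {n : ℕ} (ρ : Rn n → ℝ) (w : Rn n → ℝ) : Prop :=
  ∃ C > (0 : ℝ), ∀ (x : Rn n) (r : ℝ), 0 < r → r ≤ ρ x →
    wMeas w (Metric.ball x r) ≤ ENNReal.ofReal C * volume (Metric.ball x r) *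
      essInf (fun y => ENNReal.ofReal (w y)) (volume.restrict (Metric.ball x r))

/-- The class `A_p^{ρ,loc}` for `1 < p < ∞`. -/
def IsAploc {n : ℕ} (ρ : Rn n → ℝ) (p : ℝ) (w : Rn n → ℝ) : Prop :=
  ∃ C > (0 : ℝ), ∀ (x : Rn n) (r : ℝ), 0 < r → r ≤ ρ x →
    wMeas w (Metric.ball x r) *
      (∫⁻ y in Metric.ball x r, ENNReal.ofReal (w y ^ (1 - p / (p - 1)))) ^ (p - 1) ≤
      ENNReal.ofReal C * (volume (Metric.ball x r)) ^ p

/-- `A_∞^{ρ,loc} = ∪_{p ≥ 1} A_p^{ρ,loc}`. -/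
def IsAinfLoc {n : ℕ} (ρ : Rn n → ℝ) (w : Rn n → ℝ) : Prop :=
  IsA1loc ρ w ∨ ∃ p > (1 : ℝ), IsAploc ρ p w

/-- The class `A₁^{ρ,θ}`. -/
def IsA1rho {n : ℕ} (ρ : Rn n → ℝ) (θ : ℝ) (w : Rn n → ℝ) : Prop :=
  ∃ C > (0 : ℝ), ∀ (c : Rn n) (r : ℝ), 0 < r →
    wMeas w (cube c r) ≤ ENNReal.ofReal (C * (psi ρ θ c r * r ^ n)) *
      essInf (fun x => ENNReal.ofReal (w x)) (volume.restrict (cube c r))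

/-- The class `A_∞^ρ(μ)`. -/
def IsAinfRhoMu {n : ℕ} (ρ : Rn n → ℝ) (μ w : Rn n → ℝ) : Prop :=
  ∃ θ ≥ (0 : ℝ), ∃ ε > (0 : ℝ), ∃ C > (0 : ℝ), ∀ (c : Rn n) (r : ℝ), 0 < r →
    ∀ E ⊆ cube c r, MeasurableSet E →
      wMeas (fun x => w x * μ x) E ≤ ENNReal.ofReal (C * psi ρ θ c r) *
        (wMeas μ E / wMeas μ (cube c r)) ^ ε * wMeas (fun x => w x * μ x) (cube c r)

/-- The class `A_∞^ρ`. -/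
def IsAinfRho {n : ℕ} (ρ : Rn n → ℝ) (w : Rn n → ℝ) : Prop :=
  ∃ θ ≥ (0 : ℝ), ∃ δ > (0 : ℝ), ∃ C > (0 : ℝ), ∀ (c : Rn n) (r : ℝ), 0 < r →
    ∀ E ⊆ cube c r, MeasurableSet E →
      wMeas w E ≤ ENNReal.ofReal (C * psi ρ θ c r) *
        (volume E / ENNReal.ofReal (r ^ n)) ^ δ * wMeas w (cube c r)

/-- Membership in `RH_∞^{ρ,θ}` with constant `C`. -/
def IsRHinf {n : ℕ} (ρ : Rn n → ℝ) (θ : ℝ) (w : Rn n → ℝ) (C : ℝ) : Prop :=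
  ∀ (c : Rn n) (r : ℝ), 0 < r →
    essSup (fun x => ENNReal.ofReal (w x)) (volume.restrict (cube c r)) ≤
      ENNReal.ofReal (C * psi ρ θ c r) * ((ENNReal.ofReal (r ^ n))⁻¹ * wMeas w (cube c r))

/-- An `η`-sparse family of cubes, encoded by their (center, side length) data. -/
def IsSparse {n : ℕ} (η : ℝ) (S : Set (Rn n × ℝ)) : Prop :=
  S.Countable ∧ (∀ Q ∈ S, 0 < Q.2) ∧
  ∃ E : Rn n × ℝ → Set (Rn n),
    (∀ Q ∈ S, MeasurableSet (E Q) ∧ E Q ⊆ cube Q.1 Q.2 ∧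
      ENNReal.ofReal η * volume (cube Q.1 Q.2) ≤ volume (E Q)) ∧
    S.PairwiseDisjoint E

/-- The sparse operator `A_S^{ρ,N}`. -/
def sparseOp {n : ℕ} (ρ : Rn n → ℝ) (N : ℝ) (S : Set (Rn n × ℝ)) (f : Rn n → ℝ)
    (x : Rn n) : ℝ≥0∞ :=
  ∑' Q : S, (cube (Q : Rn n × ℝ).1 (Q : Rn n × ℝ).2).indicator
    (fun _ => (ENNReal.ofReal ((3 * (Q : Rn n × ℝ).2) ^ n))⁻¹ *
      (∫⁻ y in cube (Q : Rn n × ℝ).1 (3 * (Q : Rn n × ℝ).2), ENNReal.ofReal |f y|) *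
      (ENNReal.ofReal (psi ρ N (Q : Rn n × ℝ).1 (Q : Rn n × ℝ).2))⁻¹) x

theorem wMeas_mono {n : ℕ} (w : Rn n → ℝ) {S T : Set (Rn n)} (h : S ⊆ T) :
    wMeas w S ≤ wMeas w T :=
  lintegral_mono_set h

/-- On a cube `Q`, the fractional maximal function of `χ_P` dominates
`(ψ_θ(Q)|Q|)^{α/n-1} |P ∩ Q|`. -/
theorem le_fracMax_indicator {n : ℕ} (ρ : Rn n → ℝ) (θ α : ℝ) {P : Set (Rn n)}
    (hP : MeasurableSet P) {x y : Rn n} {r : ℝ} (hr : 0 < r) (hy : y ∈ cube x r) :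
    volume (P ∩ cube x r) * ENNReal.ofReal ((r ^ n * psi ρ θ x r) ^ (α / n - 1)) ≤
      fracMax n ρ θ α (P.indicator fun _ => (1 : ℝ)) y := by
  have hint : ∫⁻ z in cube x r, ENNReal.ofReal |P.indicator (fun _ => (1 : ℝ)) z| =
      volume (P ∩ cube x r) := by
    have h : (fun z => ENNReal.ofReal |P.indicator (fun _ => (1 : ℝ)) z|) =
        P.indicator fun _ => (1 : ℝ≥0∞) := by
      ext z
      by_cases hz : z ∈ P <;> simp [hz]
    rw [h, lintegral_indicator_const hP, one_mul, Measure.restrict_apply hP]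
  unfold fracMax
  refine le_iSup_of_le x (le_iSup_of_le r (le_iSup_of_le hr (le_iSup_of_le hy ?_)))
  rw [hint, mul_comm (psi ρ θ x r), mul_comm]

/-- If `F ≥ K` on `S`, then `w(S)^{1/q} K ≤ ‖F‖_{L^{q,∞}(w)}`. -/
theorem wMeas_rpow_mul_le_weakNormE {n : ℕ} {q : ℝ} (hq : 0 ≤ q) (w : Rn n → ℝ)
    (F : Rn n → ℝ≥0∞) {S : Set (Rn n)} {K : ℝ≥0∞} (h : ∀ y ∈ S, K ≤ F y) :
    wMeas w S ^ (1 / q) * K ≤ weakNormE q w F := by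
  rw [mul_comm]
  refine ENNReal.mul_le_of_forall_lt fun a ha b hb => ?_
  rcases eq_or_ne a 0 with rfl | ha0
  · simp
  have hatop : a ≠ ∞ := ha.ne_top
  unfold weakNormE
  refine le_iSup_of_le a.toReal (le_iSup_of_le (ENNReal.toReal_pos ha0 hatop) ?_)
  rw [ENNReal.ofReal_toReal hatop]
  gcongr
  refine hb.le.trans (ENNReal.rpow_le_rpow (wMeas_mono w fun y hy => ?_) (by positivity))
  exact ha.trans_le (h y hy)

/-- A restricted weak type bound on indicators implies
`‖μ,ν‖_{A_{p,q,α}^{ρ,θ,R}} ≤ c`; in particular `‖μ,ν‖_{A_{p,q,α}^{ρ,θ,R}} < ∞`. -/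
theorem statement2 (n : ℕ) (ρ : Rn n → ℝ) (hρ : IsCriticalRadius ρ)
    (θ α p q : ℝ) (hθ : 0 ≤ θ) (hα : 0 ≤ α) (hαn : α < n) (hp : 1 ≤ p) (hpq : p ≤ q)
    (μ ν : Rn n → ℝ) (hμ : IsWeight μ) (hν : IsWeight ν)
    (c : ℝ) (hc : 0 < c)
    (hbd : ∀ E : Set (Rn n), MeasurableSet E →
      weakNormE q ν (fracMax n ρ θ α (E.indicator fun _ => (1 : ℝ))) ≤
        ENNReal.ofReal c * (wMeas μ E) ^ (1 / p)) :
    normApqR ρ θ α p q μ ν ≤ ENNReal.ofReal c ∧ normApqR ρ θ α p q μ ν ≠ ∞ := by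
  have hle : normApqR ρ θ α p q μ ν ≤ ENNReal.ofReal c := by
    unfold normApqR
    refine iSup_le fun x => iSup_le fun r => iSup_le fun hr => ?_
    simp only [ENNReal.mul_iSup]
    refine iSup_le fun P => iSup_le fun hP => iSup_le fun hP0 => iSup_le fun hPtop => ?_
    have hq : 0 ≤ q := by linarith
    have h := (wMeas_rpow_mul_le_weakNormE hq ν _
      fun y hy => le_fracMax_indicator (x := x) ρ θ α hP hr hy).trans (hbd P hP)
    rw [← mul_assoc, ENNReal.rpow_neg, ← div_eq_mul_inv]
    exact ENNReal.div_le_of_le_mul h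
  exact ⟨hle, ne_top_of_le_ne_top ENNReal.ofReal_ne_top hle⟩
end
end

section
/- Let ρ be a critical radius function on ℝ^n, θ ≥ 0, 1 < p < ∞, η ∈ (0,1), and let S be an η-sparse family of cubes. If ω ∈ A_p^{ρ,θ,R} and N ≥ (p+1)θ, then there is a constant C depending only on n, p, θ and η such that for every measurable f, ‖A_S^{ρ,N}f‖_{L^{p,∞}(ω)} ≤ C·([ω]_{A_p^{ρ,θ,R}})^{p+1}·‖f‖_{L^{p,1}(ω)}. -/
open MeasureTheory ENNReal Set
noncomputable section

/-- Hölder's inequality between `L^{q,∞}` and `L^{q',1}`, tested on an indicator function. -/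
theorem lintegral_le_of_weak_bound {X : Type*} [MeasurableSpace X] (μ : Measure X) (A : Set X)
    {q : ℝ} (hq : 1 < q) {F : X → ℝ} (hF : AEMeasurable F μ) (hF0 : ∀ x, 0 ≤ F x) (K : ℝ≥0∞)
    (h : ∀ t : ℝ, 0 < t → ENNReal.ofReal t * μ {x | t < F x} ^ (1 / q) ≤ K) :
    ∫⁻ x in A, ENNReal.ofReal (F x) ∂μ ≤ ENNReal.ofReal (q / (q - 1)) * K * μ A ^ (1 - 1 / q) := by
  have hq0 : 0 < q := by linarith
  have hq1 : 0 < q - 1 := by linarith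
  have hexp : 0 < 1 - 1 / q := by
    rw [sub_pos, div_lt_one hq0]; exact hq
  have hc : ENNReal.ofReal (q / (q - 1)) ≠ 0 := by
    simpa using div_pos hq0 hq1
  by_cases hA0 : μ A = 0
  · rw [Measure.restrict_eq_zero.2 hA0]; simp
  rw [lintegral_eq_lintegral_meas_lt (μ.restrict A) (Filter.Eventually.of_forall hF0) hF.restrict]
  by_cases hK0 : K = 0
  · rw [setLIntegral_congr_fun (g := fun _ => 0) measurableSet_Ioi]
    · simp
    · intro t ht
      have h1 := h t ht
      rw [hK0, nonpos_iff_eq_zero, mul_eq_zero, ENNReal.rpow_eq_zero_iff] at h1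
      have h2 : μ {x | t < F x} = 0 := by
        rcases h1 with h1 | h1 | h1
        · simp only [ENNReal.ofReal_eq_zero] at h1
          exact absurd ht (not_lt.2 h1)
        · exact h1.1
        · exact absurd h1.2 (not_lt.2 (by positivity))
      exact le_antisymm ((Measure.restrict_apply_le _ _).trans h2.le) bot_le
  have hApos : μ A ^ (1 - 1 / q) ≠ 0 := by
    rw [Ne, ENNReal.rpow_eq_zero_iff]
    rintro (⟨h0, -⟩ | ⟨-, h0⟩)
    · exact hA0 h0
    · exact absurd h0 hexp.not_gt
  by_cases hK : K = ∞
  · rw [hK, ENNReal.mul_top hc, ENNReal.top_mul hApos]; exact le_top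
  by_cases hA : μ A = ∞
  · rw [hA, ENNReal.top_rpow_of_pos hexp, ENNReal.mul_top (mul_ne_zero hc hK0)]; exact le_top
  obtain ⟨k, hk, rfl⟩ : ∃ k : ℝ, 0 < k ∧ K = ENNReal.ofReal k :=
    ⟨K.toReal, ENNReal.toReal_pos hK0 hK, (ENNReal.ofReal_toReal hK).symm⟩
  obtain ⟨m, hm, hmA⟩ : ∃ m : ℝ, 0 < m ∧ μ A = ENNReal.ofReal m :=
    ⟨(μ A).toReal, ENNReal.toReal_pos hA0 hA, (ENNReal.ofReal_toReal hA).symm⟩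
  set s : ℝ := k * m ^ (-(1 / q)) with hs
  have hs0 : 0 < s := by positivity
  rw [← Ioc_union_Ioi_eq_Ioi hs0.le,
    lintegral_union measurableSet_Ioi
      (Set.disjoint_left.2 fun x hx hx' => absurd hx.2 (not_le.2 hx'))]
  have h1 : ∫⁻ t in Ioc 0 s, μ.restrict A {x | t < F x} ≤ ENNReal.ofReal (k * m ^ (1 - 1 / q)) := by
    calc ∫⁻ t in Ioc 0 s, μ.restrict A {x | t < F x} ≤ ∫⁻ t in Ioc 0 s, μ A := by
          refine lintegral_mono fun t => ?_
          exact (measure_mono (subset_univ _)).trans (by simp)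
      _ = ENNReal.ofReal (k * m ^ (1 - 1 / q)) := by
          rw [setLIntegral_const, hmA, Real.volume_Ioc, ← ENNReal.ofReal_mul hm.le, sub_zero, hs,
            sub_eq_add_neg, Real.rpow_add hm, Real.rpow_one]
          congr 1; ring
  have h2 : ∫⁻ t in Ioi s, μ.restrict A {x | t < F x} ≤
      ENNReal.ofReal (k * m ^ (1 - 1 / q) / (q - 1)) := by
    calc ∫⁻ t in Ioi s, μ.restrict A {x | t < F x} ≤
          ∫⁻ t in Ioi s, ENNReal.ofReal (k ^ q * t ^ (-q)) := by
          refine setLIntegral_mono' measurableSet_Ioi fun t ht => ?_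
          have ht0 : 0 < t := hs0.trans ht
          refine (Measure.restrict_apply_le _ _).trans ?_
          have h3 := h t ht0
          rw [mul_comm, ← ENNReal.le_div_iff_mul_le (by simp [ht0]) (by simp),
            ← ENNReal.ofReal_div_of_pos ht0, one_div, ENNReal.rpow_inv_le_iff hq0,
            ENNReal.ofReal_rpow_of_pos (by positivity)] at h3
          rwa [Real.rpow_neg ht0.le, ← div_eq_mul_inv, ← Real.div_rpow hk.le ht0.le]
      _ = ENNReal.ofReal (∫ t in Ioi s, k ^ q * t ^ (-q)) := by
          rw [← ofReal_integral_eq_lintegral_ofReal]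
          · exact (integrableOn_Ioi_rpow_of_lt (by linarith) hs0).const_mul _
          · refine (ae_restrict_iff' measurableSet_Ioi).2 (Filter.Eventually.of_forall ?_)
            intro t ht
            have ht0 : 0 < t := hs0.trans ht
            positivity
      _ = ENNReal.ofReal (k * m ^ (1 - 1 / q) / (q - 1)) := by
          rw [integral_const_mul, integral_Ioi_rpow_of_lt (by linarith) hs0, hs,
            Real.mul_rpow hk.le (by positivity), ← Real.rpow_mul hm.le,
            show -(1 / q) * (-q + 1) = 1 - 1 / q by field_simp; ring]
          congr 1
          have : k ^ q * k ^ (-q + 1) = k := by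
            rw [← Real.rpow_add hk]; simp
          rw [show -q + 1 = -(q - 1) by ring] at this ⊢
          rw [neg_div_neg_eq, mul_div_assoc', ← mul_assoc, this]
  refine (add_le_add h1 h2).trans (le_of_eq ?_)
  rw [hmA, ENNReal.ofReal_rpow_of_pos hm, ← ENNReal.ofReal_mul (by positivity),
    ← ENNReal.ofReal_mul (by positivity), ← ENNReal.ofReal_add (by positivity) (by positivity)]
  congr 1
  field_simp
  ring

/-- If `a` and `b` are in `L^{1,∞}` and `b ≤ 1`, then `∫ a^{1/p} b` is controlled by the
geometric mean of their quasi-norms. -/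
theorem lintegral_rpow_mul_le_of_weak_bound {X : Type*} [MeasurableSpace X] (μ : Measure X)
    {p : ℝ} (hp : 1 < p) {a b : X → ℝ} (ha : Measurable a) (hb : Measurable b)
    (ha0 : ∀ x, 0 ≤ a x) (hb0 : ∀ x, 0 ≤ b x) (hb1 : ∀ x, b x ≤ 1) (A B : ℝ≥0∞)
    (hA : ∀ t : ℝ, 0 < t → ENNReal.ofReal t * μ {x | t < a x} ≤ A)
    (hB : ∀ t : ℝ, 0 < t → ENNReal.ofReal t * μ {x | t < b x} ≤ B) :
    ∫⁻ x, ENNReal.ofReal (a x ^ (1 / p)) * ENNReal.ofReal (b x) ∂μ ≤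
      ENNReal.ofReal (p / (p - 1)) * ENNReal.ofReal p * A ^ (1 / p) * B ^ (1 - 1 / p) := by
  have hp0 : 0 < p := by linarith
  have hexp : 0 < 1 - 1 / p := by
    rw [sub_pos, div_lt_one hp0]; exact hp
  have hF : Measurable fun x => a x ^ (1 / p) := ha.pow_const _
  have key : ∀ s : Set X, ∫⁻ x in s, ENNReal.ofReal (a x ^ (1 / p)) ∂μ ≤
      ENNReal.ofReal (p / (p - 1)) * A ^ (1 / p) * μ s ^ (1 - 1 / p) := by
    intro s
    refine lintegral_le_of_weak_bound μ s hp hF.aemeasurable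
      (fun x => Real.rpow_nonneg (ha0 x) _) _ fun t ht => ?_
    have h1 := hA (t ^ p) (by positivity)
    have h2 : {x | t < a x ^ (1 / p)} = {x | t ^ p < a x} := by
      ext x
      rw [mem_ofPred_eq, mem_ofPred_eq, one_div, Real.lt_rpow_inv_iff_of_pos ht.le (ha0 x) hp0]
    rw [h2]
    calc ENNReal.ofReal t * μ {x | t ^ p < a x} ^ (1 / p)
        = (ENNReal.ofReal (t ^ p) * μ {x | t ^ p < a x}) ^ (1 / p) := by
          rw [ENNReal.mul_rpow_of_nonneg _ _ (by positivity),
            ENNReal.ofReal_rpow_of_pos (by positivity), ← Real.rpow_mul ht.le,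
            mul_one_div_cancel hp0.ne', Real.rpow_one]
      _ ≤ _ := ENNReal.rpow_le_rpow h1 (by positivity)
  have h1 : ∫⁻ x, ENNReal.ofReal (a x ^ (1 / p)) * ENNReal.ofReal (b x) ∂μ =
      ∫⁻ t in Ioi (0 : ℝ), ∫⁻ x in {x | t < b x}, ENNReal.ofReal (a x ^ (1 / p)) ∂μ := by
    have h2 := lintegral_withDensity_eq_lintegral_mul μ (f := fun x => ENNReal.ofReal (a x ^ (1 / p)))
      hF.ennreal_ofReal (g := fun x => ENNReal.ofReal (b x)) hb.ennreal_ofReal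
    simp only [Pi.mul_apply] at h2
    rw [← h2, lintegral_eq_lintegral_meas_lt _ (Filter.Eventually.of_forall hb0) hb.aemeasurable]
    refine lintegral_congr fun t => ?_
    exact withDensity_apply _ (measurableSet_lt measurable_const hb)
  rw [h1]
  calc ∫⁻ t in Ioi (0 : ℝ), ∫⁻ x in {x | t < b x}, ENNReal.ofReal (a x ^ (1 / p)) ∂μ
      ≤ ∫⁻ t in Ioi (0 : ℝ), (Ioc (0 : ℝ) 1).indicator (fun t =>
          ENNReal.ofReal (p / (p - 1)) * A ^ (1 / p) * B ^ (1 - 1 / p) *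
            ENNReal.ofReal (t ^ (1 / p - 1))) t := by
        refine setLIntegral_mono' measurableSet_Ioi fun t ht => ?_
        rw [mem_Ioi] at ht
        by_cases ht1 : t ≤ 1
        · rw [indicator_of_mem (mem_Ioc.2 ⟨ht, ht1⟩)]
          refine (key _).trans ?_
          rw [mul_assoc, mul_assoc (ENNReal.ofReal (p / (p - 1)) * A ^ (1 / p))]
          rw [mul_assoc]
          gcongr
          have h3 := hB t ht
          rw [mul_comm, ← ENNReal.le_div_iff_mul_le (by simp [ht]) (by simp)] at h3
          refine (ENNReal.rpow_le_rpow h3 hexp.le).trans (le_of_eq ?_)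
          rw [ENNReal.div_rpow_of_nonneg _ _ hexp.le, div_eq_mul_inv,
            ENNReal.ofReal_rpow_of_pos ht, ← ENNReal.ofReal_inv_of_pos (by positivity),
            ← Real.rpow_neg ht.le, neg_sub]
        · have : {x | t < b x} = ∅ := by
            ext x
            simp only [mem_ofPred_eq, mem_empty_iff_false, iff_false, not_lt]
            exact (hb1 x).trans (not_le.1 ht1).le
          rw [this]; simp
    _ = ENNReal.ofReal (p / (p - 1)) * A ^ (1 / p) * B ^ (1 - 1 / p) *
          ∫⁻ t in Ioc (0 : ℝ) 1, ENNReal.ofReal (t ^ (1 / p - 1)) := by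
        rw [lintegral_indicator measurableSet_Ioc, Measure.restrict_restrict measurableSet_Ioc,
          inter_eq_self_of_subset_left (fun x hx => hx.1), lintegral_const_mul _ (by fun_prop)]
    _ = ENNReal.ofReal (p / (p - 1)) * A ^ (1 / p) * B ^ (1 - 1 / p) * ENNReal.ofReal p := by
        congr 1
        have hlt : -1 < 1 / p - 1 := by
          have : 0 < 1 / p := by positivity
          linarith
        have hint := (intervalIntegral.intervalIntegrable_rpow' (a := 0) (b := 1) hlt)
        rw [← ofReal_integral_eq_lintegral_ofReal
          ((intervalIntegrable_iff_integrableOn_Ioc_of_le zero_le_one).1 hint),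
          ← intervalIntegral.integral_of_le zero_le_one, integral_rpow (Or.inl hlt)]
        · congr 1
          rw [sub_add_cancel, Real.one_rpow, Real.zero_rpow (by positivity)]
          simp
        · refine (ae_restrict_iff' measurableSet_Ioc).2 (Filter.Eventually.of_forall ?_)
          intro t ht
          exact Real.rpow_nonneg ht.1.le _
    _ = _ := by ring

/-- Discrete version of `lintegral_rpow_mul_le_of_weak_bound`. -/
theorem sum_rpow_mul_le_of_weak_bound {ι : Type*} (T : Finset ι) (w : ι → ℝ≥0∞)
    {p : ℝ} (hp : 1 < p) {a b : ι → ℝ}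
    (ha0 : ∀ x, 0 ≤ a x) (hb0 : ∀ x, 0 ≤ b x) (hb1 : ∀ x, b x ≤ 1) (A B : ℝ≥0∞)
    (hA : ∀ t : ℝ, 0 < t → ENNReal.ofReal t * ∑ x ∈ T with t < a x, w x ≤ A)
    (hB : ∀ t : ℝ, 0 < t → ENNReal.ofReal t * ∑ x ∈ T with t < b x, w x ≤ B) :
    ∑ x ∈ T, ENNReal.ofReal (a x ^ (1 / p)) * ENNReal.ofReal (b x) * w x ≤
      ENNReal.ofReal (p / (p - 1)) * ENNReal.ofReal p * A ^ (1 / p) * B ^ (1 - 1 / p) := by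
  let _ : MeasurableSpace ι := ⊤
  have hm : ∀ c : ι → ℝ, Measurable c := fun c => measurable_from_top
  have hμ : ∀ (c : ι → ℝ) (t : ℝ),
      (∑ x ∈ T, w x • Measure.dirac x) {x | t < c x} = ∑ x ∈ T with t < c x, w x := by
    intro c t
    rw [Measure.finsetSum_apply, Finset.sum_filter]
    refine Finset.sum_congr rfl fun x _ => ?_
    rw [Measure.smul_apply, Measure.dirac_apply' x MeasurableSpace.measurableSet_top]
    simp [indicator_apply]
  have := lintegral_rpow_mul_le_of_weak_bound (∑ x ∈ T, w x • Measure.dirac x) hp (hm a) (hm b)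
    ha0 hb0 hb1 A B (fun t ht => by rw [hμ]; exact hA t ht) (fun t ht => by rw [hμ]; exact hB t ht)
  rw [lintegral_finsetSum_measure] at this
  refine le_trans (le_of_eq (Finset.sum_congr rfl fun x _ => ?_)) this
  rw [lintegral_smul_measure, lintegral_dirac' _ measurable_from_top, smul_eq_mul, mul_comm]

section Cubes

variable {n : ℕ}

theorem cube_eq_preimage (c : Rn n) {r : ℝ} (hr : 0 ≤ r) :
    cube c r = WithLp.ofLp ⁻¹' Metric.closedBall (WithLp.ofLp c) (r / 2) := by
  ext y
  rw [mem_preimage, Metric.mem_closedBall, dist_pi_le_iff (by positivity)]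
  rfl

theorem measurableSet_cube (c : Rn n) {r : ℝ} (hr : 0 ≤ r) : MeasurableSet (cube c r) := by
  rw [cube_eq_preimage c hr]
  exact Metric.isClosed_closedBall.measurableSet.preimage (WithLp.measurable_ofLp _ _)

theorem volume_cube (c : Rn n) {r : ℝ} (hr : 0 ≤ r) :
    volume (cube c r) = ENNReal.ofReal (r ^ n) := by
  rw [cube_eq_preimage c hr, (PiLp.volume_preserving_ofLp (Fin n)).measure_preimage
    Metric.isClosed_closedBall.measurableSet.nullMeasurableSet,
    Real.volume_pi_closedBall _ (by positivity), Fintype.card_fin, mul_div_cancel₀ _ two_ne_zero]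

theorem isCompact_cube (c : Rn n) {r : ℝ} (hr : 0 ≤ r) : IsCompact (cube c r) := by
  rw [cube_eq_preimage c hr]
  exact (PiLp.homeomorph 2 fun _ : Fin n => ℝ).isCompact_preimage.2 (isCompact_closedBall _ _)

theorem cube_mono (c : Rn n) {r s : ℝ} (h : r ≤ s) : cube c r ⊆ cube c s :=
  fun _ hy i => (hy i).trans (by linarith)

theorem cube_subset_cube {c d : Rn n} {r s t : ℝ} (hd : d ∈ cube c r) (h : r + s ≤ t) :
    cube c s ⊆ cube d t := by
  intro y hy i
  have h1 := hy i
  have h2 := hd i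
  rw [abs_le] at *
  constructor <;> linarith

theorem cube_subset_cube' {c d : Rn n} {r s t : ℝ} (hd : d ∈ cube c r) (h : r + s ≤ t) :
    cube d s ⊆ cube c t := by
  intro y hy i
  have h1 := hy i
  have h2 := hd i
  rw [abs_le] at *
  constructor <;> linarith

/-- A weak type bound for families of cubes, valid for every measure. -/
theorem exists_measure_biUnion_cube_le (n : ℕ) : ∃ B : ℕ, ∀ (μ : Measure (Rn n))
    (T : Finset (Rn n × ℝ)), (∀ Q ∈ T, 0 < Q.2) → ∀ P : Set (Rn n), MeasurableSet P →
    ∀ t : ℝ≥0∞, (∀ Q ∈ T, t * μ (cube Q.1 (5 * Q.2)) ≤ μ (P ∩ cube Q.1 (3 * Q.2))) →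
    t * μ (⋃ Q ∈ T, cube Q.1 Q.2) ≤ B * μ P := by
  refine ⟨Besicovitch.multiplicity (Fin n → ℝ), fun μ T hT P hP t h => ?_⟩
  set U : Set (Rn n) := ⋃ Q ∈ T, cube Q.1 Q.2 with hU
  have hex : ∀ x : U, ∃ Q ∈ T, (x : Rn n) ∈ cube Q.1 Q.2 := fun x => by
    obtain ⟨Q, hQ, hx⟩ := mem_iUnion₂.1 x.2
    exact ⟨Q, hQ, hx⟩
  choose Q hQT hxQ using hex
  have hpos : ∀ x, 0 < (Q x).2 := fun x => hT _ (hQT x)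
  let q : Besicovitch.BallPackage U (Fin n → ℝ) :=
    { c := fun x => WithLp.ofLp (x : Rn n)
      r := fun x => 4 * (Q x).2 / 2
      rpos := fun x => by have := hpos x; positivity
      r_bound := ∑ R ∈ T, 4 * R.2 / 2
      r_le := fun x => Finset.single_le_sum (f := fun R : Rn n × ℝ => 4 * R.2 / 2)
        (fun R hR => by have := hT R hR; positivity) (hQT x) }
  obtain ⟨s, hdisj, hcov⟩ := Besicovitch.exist_disjoint_covering_families
    (Besicovitch.one_lt_goodτ (Fin n → ℝ))
    (Besicovitch.isEmpty_satelliteConfig_multiplicity (Fin n → ℝ)) q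
  have hball : ∀ x : U, cube (x : Rn n) (4 * (Q x).2) =
      WithLp.ofLp ⁻¹' Metric.closedBall (q.c x) (q.r x) := fun x =>
    cube_eq_preimage _ (by have := hpos x; positivity)
  have hcount : ∀ i, (s i).Countable := fun i => by
    refine (hdisj i).countable_of_nonempty_interior fun x _ => ⟨q.c x, ?_⟩
    exact Metric.ball_subset_interior_closedBall (Metric.mem_ball_self (q.rpos x))
  have hcov' : U ⊆ ⋃ i, ⋃ x ∈ s i, cube (x : Rn n) (4 * (Q x).2) := by
    intro y hy
    have h1 := hcov ⟨⟨y, hy⟩, rfl⟩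
    simp only [mem_iUnion] at h1 ⊢
    obtain ⟨i, x, hx, hyx⟩ := h1
    refine ⟨i, x, hx, ?_⟩
    rw [hball]
    exact Metric.ball_subset_closedBall hyx
  have hx : ∀ x : U, t * μ (cube (x : Rn n) (4 * (Q x).2)) ≤
      μ (P ∩ cube (x : Rn n) (4 * (Q x).2)) := fun x => by
    calc t * μ (cube (x : Rn n) (4 * (Q x).2)) ≤ t * μ (cube (Q x).1 (5 * (Q x).2)) := by
          gcongr
          exact cube_subset_cube' (hxQ x) (by linarith)
      _ ≤ μ (P ∩ cube (Q x).1 (3 * (Q x).2)) := h _ (hQT x)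
      _ ≤ _ := by
          gcongr
          exact cube_subset_cube (hxQ x) (by linarith)
  have hfam : ∀ i, t * μ (⋃ x ∈ s i, cube (x : Rn n) (4 * (Q x).2)) ≤ μ P := fun i => by
    have hd : (s i).PairwiseDisjoint fun x : U => P ∩ cube (x : Rn n) (4 * (Q x).2) := by
      intro x hxs y hys hxy
      have h1 : Disjoint (cube (x : Rn n) (4 * (Q x).2)) (cube (y : Rn n) (4 * (Q y).2)) := by
        rw [hball, hball]
        exact (hdisj i hxs hys hxy).preimage _
      exact h1.mono inter_subset_right inter_subset_right
    calc t * μ (⋃ x ∈ s i, cube (x : Rn n) (4 * (Q x).2))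
        ≤ t * ∑' x : s i, μ (cube ((x : U) : Rn n) (4 * (Q x).2)) := by
          gcongr
          exact measure_biUnion_le μ (hcount i) _
      _ ≤ ∑' x : s i, μ (P ∩ cube ((x : U) : Rn n) (4 * (Q x).2)) := by
          rw [← ENNReal.tsum_mul_left]
          exact ENNReal.tsum_le_tsum fun x => hx x
      _ = μ (⋃ x ∈ s i, P ∩ cube (x : Rn n) (4 * (Q x).2)) := by
          rw [measure_biUnion (hcount i) hd]
          exact fun x _ => hP.inter (measurableSet_cube _ (by have := hpos x; positivity))
      _ ≤ μ P := measure_mono (iUnion₂_subset fun x _ => inter_subset_left)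
  calc t * μ U ≤ t * ∑ i, μ (⋃ x ∈ s i, cube (x : Rn n) (4 * (Q x).2)) := by
        gcongr
        exact (measure_mono hcov').trans (measure_iUnion_fintype_le _ _)
    _ ≤ ∑ i : Fin (Besicovitch.multiplicity (Fin n → ℝ)), μ P := by
        rw [Finset.mul_sum]
        exact Finset.sum_le_sum fun i _ => hfam i
    _ = _ := by simp

end Cubes

section Weights

variable {n : ℕ} {ω : Rn n → ℝ}

theorem wMeas_eq_withDensity (w : Rn n → ℝ) (s : Set (Rn n)) :
    wMeas w s = (volume.withDensity fun x => ENNReal.ofReal (w x)) s :=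
  (withDensity_apply' _ _).symm

theorem IsWeight.aemeasurable (hω : IsWeight ω) : AEMeasurable ω volume :=
  hω.1.aestronglyMeasurable.aemeasurable

theorem IsWeight.wMeas_cube_ne_top (hω : IsWeight ω) (c : Rn n) {r : ℝ} (hr : 0 ≤ r) :
    wMeas ω (cube c r) ≠ ∞ :=
  (hω.1.integrableOn_isCompact (isCompact_cube c hr)).lintegral_lt_top.ne

theorem IsWeight.wMeas_cube_ne_zero (hω : IsWeight ω) (c : Rn n) {r : ℝ} (hr : 0 < r) :
    wMeas ω (cube c r) ≠ 0 := by
  intro h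
  rw [wMeas_eq_withDensity] at h
  have hac := withDensity_absolutelyContinuous' (μ := volume)
    (f := fun x => ENNReal.ofReal (ω x)) hω.aemeasurable.ennreal_ofReal
    (hω.2.mono fun x hx => by simpa using hx)
  have h1 := hac h
  rw [volume_cube c hr.le, ENNReal.ofReal_eq_zero] at h1
  exact absurd h1 (not_le.2 (by positivity))

theorem psi_pos {ρ : Rn n → ℝ} (hρ : ∀ x, 0 < ρ x) (θ : ℝ) (c : Rn n) {r : ℝ} (hr : 0 < r) :
    0 < psi ρ θ c r := by
  have := hρ c
  unfold psi
  positivity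

/-- The `A_p^{ρ,θ,R}` condition controls the density of a set in a cube. -/
theorem volume_inter_cube_mul_le {ρ : Rn n → ℝ} (hρ : ∀ x, 0 < ρ x) {p θ : ℝ} (hp : 1 < p)
    (hω : IsWeight ω) (c : Rn n) {r : ℝ} (hr : 0 < r) {P : Set (Rn n)} (hP : MeasurableSet P) :
    volume (P ∩ cube c r) * wMeas ω (cube c r) ^ (1 / p) ≤
      ENNReal.ofReal p * ApqR ρ θ 0 p p ω ω * ENNReal.ofReal (r ^ n * psi ρ θ c r) *
        wMeas ω (P ∩ cube c r) ^ (1 / p) := by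
  have hp1 : 0 < p - 1 := by linarith
  have hx : 0 < r ^ n * psi ρ θ c r := mul_pos (by positivity) (psi_pos hρ θ c hr)
  set K := weakNormR (conjE p) ω ((cube c r).indicator fun x => (ω x)⁻¹) with hK
  set μ := (volume : Measure (Rn n)).withDensity fun x => ENNReal.ofReal (ω x) with hμ
  set F : Rn n → ℝ := fun x => |(cube c r).indicator (fun x => (ω x)⁻¹) x| with hF
  have hs : MeasurableSet (P ∩ cube c r) := hP.inter (measurableSet_cube c hr.le)
  have hFm : AEMeasurable F volume :=
    (hω.aemeasurable.inv.indicator (measurableSet_cube c hr.le)).abs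
  have hconj : (conjE p).toReal = p / (p - 1) := by
    rw [conjE, if_neg hp.ne', ENNReal.toReal_ofReal (by positivity)]
  have hconj' : conjE p ≠ ∞ := by
    rw [conjE, if_neg hp.ne']; exact ENNReal.ofReal_ne_top
  have hbound : ∀ t : ℝ, 0 < t →
      ENNReal.ofReal t * μ {x | t < F x} ^ (1 / (p / (p - 1))) ≤ K := by
    intro t ht
    rw [hK, weakNormR, if_neg hconj', hconj, ← wMeas_eq_withDensity]
    exact le_iSup₂ (f := fun (l : ℝ) (_ : 0 < l) => ENNReal.ofReal l *
      wMeas ω {x | l < |(cube c r).indicator (fun x => (ω x)⁻¹) x|} ^ (1 / (p / (p - 1)))) t ht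
  have hvol : volume (P ∩ cube c r) ≤ ENNReal.ofReal p * K * wMeas ω (P ∩ cube c r) ^ (1 / p) := by
    have h1 := lintegral_le_of_weak_bound μ (P ∩ cube c r)
      (q := p / (p - 1)) (by rw [lt_div_iff₀ hp1]; linarith)
      (hFm.mono_ac (withDensity_absolutelyContinuous _ _)) (fun x => abs_nonneg _) K hbound
    have h2 : p / (p - 1) / (p / (p - 1) - 1) = p := by
      have : p - (p - 1) ≠ 0 := by norm_num
      field_simp
      norm_num
    have h3 : 1 - 1 / (p / (p - 1)) = 1 / p := by
      field_simp
      norm_num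
    rw [h2, h3, ← wMeas_eq_withDensity] at h1
    refine le_trans (le_of_eq ?_) h1
    rw [setLIntegral_withDensity_eq_lintegral_mul₀ hω.aemeasurable.ennreal_ofReal
      hFm.ennreal_ofReal hs, ← setLIntegral_one]
    refine setLIntegral_congr_fun_ae hs (hω.2.mono fun x hx hxs => ?_)
    rw [Pi.mul_apply, hF, ← ENNReal.ofReal_mul hx.le]
    simp only
    rw [indicator_of_mem hxs.2, abs_of_pos (by positivity), mul_inv_cancel₀ hx.ne',
      ENNReal.ofReal_one]
  have hA : wMeas ω (cube c r) ^ (1 / p) * K ≤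
      ApqR ρ θ 0 p p ω ω * ENNReal.ofReal (r ^ n * psi ρ θ c r) := by
    have h1 : wMeas ω (cube c r) ^ (1 / p) * K *
        ENNReal.ofReal ((r ^ n * psi ρ θ c r) ^ ((0 : ℝ) / n - 1)) ≤ ApqR ρ θ 0 p p ω ω := by
      refine le_trans ?_ (le_iSup _ c)
      exact le_iSup₂ (f := fun (r : ℝ) (_ : 0 < r) => wMeas ω (cube c r) ^ (1 / p) *
        weakNormR (conjE p) ω ((cube c r).indicator fun x => (ω x)⁻¹) *
        ENNReal.ofReal ((r ^ n * psi ρ θ c r) ^ ((0 : ℝ) / n - 1))) r hr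
    rw [zero_div, zero_sub, Real.rpow_neg_one, ENNReal.ofReal_inv_of_pos hx, ← div_eq_mul_inv,
      ENNReal.div_le_iff (by simpa using hx) ENNReal.ofReal_ne_top] at h1
    exact h1
  calc volume (P ∩ cube c r) * wMeas ω (cube c r) ^ (1 / p)
      ≤ ENNReal.ofReal p * K * wMeas ω (P ∩ cube c r) ^ (1 / p) *
          wMeas ω (cube c r) ^ (1 / p) := by gcongr
    _ = ENNReal.ofReal p * (wMeas ω (cube c r) ^ (1 / p) * K) *
          wMeas ω (P ∩ cube c r) ^ (1 / p) := by ring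
    _ ≤ ENNReal.ofReal p * (ApqR ρ θ 0 p p ω ω * ENNReal.ofReal (r ^ n * psi ρ θ c r)) *
          wMeas ω (P ∩ cube c r) ^ (1 / p) := by gcongr
    _ = _ := by ring

theorem psi_five_mul_rpow_le {ρ : Rn n → ℝ} (hρ : ∀ x, 0 < ρ x) {p θ N : ℝ} (hp : 1 < p)
    (hθ : 0 ≤ θ) (hN : (p + 1) * θ ≤ N) (c : Rn n) {r : ℝ} (hr : 0 < r) :
    psi ρ θ c (5 * r) ^ (p + 1) ≤ 5 ^ (θ * (p + 1)) * psi ρ N c r := by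
  have hc := hρ c
  have h0 : 0 < r / ρ c := by positivity
  have h1 : 1 + 5 * r / ρ c ≤ 5 * (1 + r / ρ c) := by
    rw [mul_div_assoc]; linarith
  have h2 : 0 ≤ 1 + 5 * r / ρ c := by positivity
  unfold psi
  calc ((1 + 5 * r / ρ c) ^ θ) ^ (p + 1) = (1 + 5 * r / ρ c) ^ (θ * (p + 1)) :=
        (Real.rpow_mul h2 _ _).symm
    _ ≤ (5 * (1 + r / ρ c)) ^ (θ * (p + 1)) :=
        Real.rpow_le_rpow h2 h1 (mul_nonneg hθ (by linarith))
    _ = 5 ^ (θ * (p + 1)) * (1 + r / ρ c) ^ (θ * (p + 1)) :=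
        Real.mul_rpow (by norm_num) (by positivity)
    _ ≤ 5 ^ (θ * (p + 1)) * (1 + r / ρ c) ^ N := by
        gcongr
        · linarith
        · linarith

/-- The constant, depending on `n`, `p`, `θ` and `η`, in the bound of a single term of the
bilinear form of the sparse operator. -/
def sparseTermConst (n : ℕ) (p θ η : ℝ) : ℝ :=
  (p * 5 ^ n) ^ (p + 1) * 5 ^ (θ * (p + 1)) / η ^ p

theorem sparseTermConst_pos (n : ℕ) {p η : ℝ} (θ : ℝ) (hp : 1 < p) (hη : 0 < η) :
    0 < sparseTermConst n p θ η := by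
  have : 0 < p := by linarith
  unfold sparseTermConst
  positivity

theorem coefficient_le {ρ : Rn n → ℝ} (hρ : ∀ x, 0 < ρ x) {p θ N η : ℝ} (hp : 1 < p)
    (hθ : 0 ≤ θ) (hη : 0 < η) (hN : (p + 1) * θ ≤ N) (c : Rn n) {r : ℝ} (hr : 0 < r) :
    ((3 * r) ^ n)⁻¹ * (psi ρ N c r)⁻¹ * (p * ((5 * r) ^ n * psi ρ θ c (5 * r))) ^ (p + 1) *
      ((η * r ^ n) ^ p)⁻¹ ≤ sparseTermConst n p θ η := by
  have hp0 : 0 < p := by linarith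
  have hψN := psi_pos hρ N c hr
  have hψ := psi_pos hρ θ c (r := 5 * r) (by positivity)
  have h1 := psi_five_mul_rpow_le hρ hp hθ hN c hr
  have hrn : 0 < r ^ n := by positivity
  have e1 : (p * ((5 * r) ^ n * psi ρ θ c (5 * r))) ^ (p + 1) =
      (p * 5 ^ n) ^ (p + 1) * ((r ^ n) ^ p * r ^ n) * psi ρ θ c (5 * r) ^ (p + 1) := by
    rw [show p * ((5 * r) ^ n * psi ρ θ c (5 * r)) = (p * 5 ^ n) * r ^ n * psi ρ θ c (5 * r) by
      rw [mul_pow]; ring, Real.mul_rpow (by positivity) hψ.le,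
      Real.mul_rpow (by positivity) hrn.le, Real.rpow_add_one hrn.ne']
  have e2 : ((3 * r) ^ n)⁻¹ ≤ (r ^ n)⁻¹ := by
    gcongr
    linarith
  rw [e1, Real.mul_rpow hη.le hrn.le, sparseTermConst]
  calc ((3 * r) ^ n)⁻¹ * (psi ρ N c r)⁻¹ *
        ((p * 5 ^ n) ^ (p + 1) * ((r ^ n) ^ p * r ^ n) * psi ρ θ c (5 * r) ^ (p + 1)) *
        (η ^ p * (r ^ n) ^ p)⁻¹
      ≤ (r ^ n)⁻¹ * (psi ρ N c r)⁻¹ *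
        ((p * 5 ^ n) ^ (p + 1) * ((r ^ n) ^ p * r ^ n) * (5 ^ (θ * (p + 1)) * psi ρ N c r)) *
        (η ^ p * (r ^ n) ^ p)⁻¹ := by gcongr
    _ = _ := by
      have : 0 < (r ^ n) ^ p := by positivity
      field_simp

/-- The bound of a single term of the bilinear form of the sparse operator. -/
theorem sparse_term_le {ρ : Rn n → ℝ} (hρ : ∀ x, 0 < ρ x) {p θ N η : ℝ} (hp : 1 < p)
    (hθ : 0 ≤ θ) (hη : 0 < η) (hN : (p + 1) * θ ≤ N) (hω : IsWeight ω) (c : Rn n) {r : ℝ}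
    (hr : 0 < r) {P E : Set (Rn n)} (hP : MeasurableSet P) (hE : MeasurableSet E)
    (hEc : E ⊆ cube c r) (hEη : ENNReal.ofReal η * volume (cube c r) ≤ volume E)
    (G : Set (Rn n)) :
    (ENNReal.ofReal ((3 * r) ^ n))⁻¹ * volume (P ∩ cube c (3 * r)) *
        (ENNReal.ofReal (psi ρ N c r))⁻¹ * wMeas ω (G ∩ cube c r) ≤
      ENNReal.ofReal (sparseTermConst n p θ η) * ApqR ρ θ 0 p p ω ω ^ (p + 1) *
        ((wMeas ω (P ∩ cube c (3 * r)) / wMeas ω (cube c (5 * r))) ^ (1 / p) *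
          (wMeas ω (G ∩ cube c (3 * r)) / wMeas ω (cube c (5 * r))) * wMeas ω E) := by
  have hp0 : 0 < p := by linarith
  have hψN := psi_pos hρ N c hr
  have hψ := psi_pos hρ θ c (r := 5 * r) (by positivity)
  set A := ApqR ρ θ 0 p p ω ω
  set W := wMeas ω (cube c (5 * r))
  have hW0 : W ≠ 0 := hω.wMeas_cube_ne_zero c (by positivity)
  have hWt : W ≠ ∞ := hω.wMeas_cube_ne_top c (by positivity)
  have hWp0 : W ^ (1 / p) ≠ 0 := by simp [ENNReal.rpow_eq_zero_iff, hW0, hWt]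
  have hWpt : W ^ (1 / p) ≠ ∞ := ENNReal.rpow_ne_top_of_nonneg (by positivity) hWt
  set X : ℝ := (5 * r) ^ n * psi ρ θ c (5 * r)
  have hX : 0 < X := mul_pos (by positivity) hψ
  have hmono : ∀ {w : Rn n → ℝ} {s t : Set (Rn n)}, s ⊆ t → wMeas w s ≤ wMeas w t := by
    intro w s t hst
    rw [wMeas_eq_withDensity, wMeas_eq_withDensity]
    exact measure_mono hst
  have h35 : cube c (3 * r) ⊆ cube c (5 * r) := cube_mono c (by linarith)
  have hv : volume (P ∩ cube c (3 * r)) ≤ ENNReal.ofReal p * A * ENNReal.ofReal X *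
      (wMeas ω (P ∩ cube c (3 * r)) / W) ^ (1 / p) := by
    have h1 := volume_inter_cube_mul_le hρ (θ := θ) hp hω c (r := 5 * r) (by positivity)
      (hP.inter (measurableSet_cube c (r := 3 * r) (by positivity)))
    rw [inter_assoc, inter_eq_self_of_subset_left h35] at h1
    rw [ENNReal.div_rpow_of_nonneg _ _ (by positivity), ← mul_div_assoc,
      ENNReal.le_div_iff_mul_le (Or.inl hWp0) (Or.inl hWpt)]
    exact h1
  have hWE : W ≤ (ENNReal.ofReal p * A * ENNReal.ofReal X) ^ p *
      (ENNReal.ofReal ((η * r ^ n) ^ p))⁻¹ * wMeas ω E := by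
    have h1 := volume_inter_cube_mul_le hρ (θ := θ) hp hω c (r := 5 * r) (by positivity) hE
    rw [inter_eq_self_of_subset_left (hEc.trans (cube_mono c (by linarith)))] at h1
    rw [volume_cube c hr.le, ← ENNReal.ofReal_mul hη.le] at hEη
    have h2 := ENNReal.rpow_le_rpow ((mul_le_mul_left hEη (W ^ (1 / p))).trans h1) hp0.le
    rw [ENNReal.mul_rpow_of_nonneg _ _ hp0.le, ENNReal.mul_rpow_of_nonneg _ _ hp0.le,
      ← ENNReal.rpow_mul, ← ENNReal.rpow_mul, one_div_mul_cancel hp0.ne', ENNReal.rpow_one,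
      ENNReal.rpow_one, ENNReal.ofReal_rpow_of_pos (by positivity)] at h2
    rw [mul_right_comm, ← div_eq_mul_inv, ENNReal.le_div_iff_mul_le (Or.inl (by
      rw [Ne, ENNReal.ofReal_eq_zero, not_le]; positivity)) (Or.inl ENNReal.ofReal_ne_top), mul_comm]
    exact h2
  have hG : wMeas ω (G ∩ cube c r) ≤ wMeas ω (G ∩ cube c (3 * r)) / W * W := by
    rw [ENNReal.div_mul_cancel hW0 hWt]
    exact hmono (inter_subset_inter_right _ (cube_mono c (by linarith)))
  have hcoef : (ENNReal.ofReal ((3 * r) ^ n))⁻¹ * (ENNReal.ofReal (psi ρ N c r))⁻¹ *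
      (ENNReal.ofReal p * A * ENNReal.ofReal X) ^ (p + 1) *
      (ENNReal.ofReal ((η * r ^ n) ^ p))⁻¹ ≤
      ENNReal.ofReal (sparseTermConst n p θ η) * A ^ (p + 1) := by
    rw [show ENNReal.ofReal p * A * ENNReal.ofReal X = ENNReal.ofReal (p * X) * A by
      rw [ENNReal.ofReal_mul hp0.le]; ring, ENNReal.mul_rpow_of_nonneg _ _ (by positivity),
      ENNReal.ofReal_rpow_of_pos (by positivity), ← ENNReal.ofReal_inv_of_pos (by positivity),
      ← ENNReal.ofReal_inv_of_pos hψN, ← ENNReal.ofReal_inv_of_pos (by positivity),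
      ← ENNReal.ofReal_mul (by positivity), ← mul_assoc, ← ENNReal.ofReal_mul (by positivity),
      mul_right_comm, ← ENNReal.ofReal_mul (by positivity)]
    gcongr
    exact coefficient_le hρ hp hθ hη hN c hr
  set Y := ENNReal.ofReal p * A * ENNReal.ofReal X
  set α := (wMeas ω (P ∩ cube c (3 * r)) / W) ^ (1 / p)
  set β := wMeas ω (G ∩ cube c (3 * r)) / W
  calc (ENNReal.ofReal ((3 * r) ^ n))⁻¹ * volume (P ∩ cube c (3 * r)) *
        (ENNReal.ofReal (psi ρ N c r))⁻¹ * wMeas ω (G ∩ cube c r)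
      ≤ (ENNReal.ofReal ((3 * r) ^ n))⁻¹ * (Y * α) * (ENNReal.ofReal (psi ρ N c r))⁻¹ *
          (β * (Y ^ p * (ENNReal.ofReal ((η * r ^ n) ^ p))⁻¹ * wMeas ω E)) := by
        gcongr
        exact hG.trans (by gcongr)
    _ = ((ENNReal.ofReal ((3 * r) ^ n))⁻¹ * (ENNReal.ofReal (psi ρ N c r))⁻¹ *
          (Y ^ p * Y) * (ENNReal.ofReal ((η * r ^ n) ^ p))⁻¹) * (α * β * wMeas ω E) := by ring
    _ ≤ _ := by
        rw [show Y ^ p * Y = Y ^ (p + 1) by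
          rw [ENNReal.rpow_add_of_nonneg _ _ hp0.le zero_le_one, ENNReal.rpow_one]]
        gcongr

end Weights

/-- The bilinear form of a sparse operator is of restricted type. -/
theorem exists_sum_sparse_term_le (n : ℕ) {p θ η : ℝ} (hp : 1 < p) (hθ : 0 ≤ θ) (hη : 0 < η) :
    ∃ B : ℕ, ∀ ρ : Rn n → ℝ, (∀ x, 0 < ρ x) → ∀ T : Finset (Rn n × ℝ), (∀ Q ∈ T, 0 < Q.2) →
    ∀ E : Rn n × ℝ → Set (Rn n), (∀ Q ∈ T, MeasurableSet (E Q) ∧ E Q ⊆ cube Q.1 Q.2 ∧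
      ENNReal.ofReal η * volume (cube Q.1 Q.2) ≤ volume (E Q)) →
    (T : Set (Rn n × ℝ)).PairwiseDisjoint E →
    ∀ ω : Rn n → ℝ, IsWeight ω → ∀ N : ℝ, (p + 1) * θ ≤ N →
    ∀ P G : Set (Rn n), MeasurableSet P → MeasurableSet G →
      ∑ Q ∈ T, (ENNReal.ofReal ((3 * Q.2) ^ n))⁻¹ * volume (P ∩ cube Q.1 (3 * Q.2)) *
        (ENNReal.ofReal (psi ρ N Q.1 Q.2))⁻¹ * wMeas ω (G ∩ cube Q.1 Q.2) ≤
      ENNReal.ofReal (sparseTermConst n p θ η * (p / (p - 1)) * B) *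
        ApqR ρ θ 0 p p ω ω ^ (p + 1) * ENNReal.ofReal p *
        (wMeas ω P ^ (1 / p) * wMeas ω G ^ (1 - 1 / p)) := by
  obtain ⟨B, hB⟩ := exists_measure_biUnion_cube_le n
  refine ⟨B, fun ρ hρ T hT E hE hdisj ω hω N hN P G hP hG => ?_⟩
  have hp0 : 0 < p := by linarith
  have hp1 : 0 < p - 1 := by linarith
  have hexp : 0 ≤ 1 - 1 / p := by
    rw [sub_nonneg, div_le_one hp0]; exact hp.le
  let a : Set (Rn n) → Rn n × ℝ → ℝ≥0∞ := fun R Q =>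
    wMeas ω (R ∩ cube Q.1 (3 * Q.2)) / wMeas ω (cube Q.1 (5 * Q.2))
  have ha1 : ∀ R, ∀ Q ∈ T, a R Q ≤ 1 := fun R Q hQ => by
    have hQ0 := hT Q hQ
    refine ENNReal.div_le_of_le_mul ?_
    rw [one_mul, wMeas_eq_withDensity, wMeas_eq_withDensity]
    exact measure_mono (inter_subset_right.trans (cube_mono _ (by linarith)))
  have hat : ∀ R, ∀ Q ∈ T, a R Q ≠ ∞ := fun R Q hQ =>
    ((ha1 R Q hQ).trans_lt ENNReal.one_lt_top).ne
  have hweak : ∀ R, MeasurableSet R → ∀ t : ℝ, 0 < t →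
      ENNReal.ofReal t * ∑ Q ∈ T with t < min (a R Q).toReal 1, wMeas ω (E Q) ≤
        B * wMeas ω R := by
    intro R hR t ht
    set T' := T.filter fun Q => t < min (a R Q).toReal 1 with hT'
    have hsub : ∀ Q ∈ T', Q ∈ T := fun Q hQ => (Finset.mem_filter.1 hQ).1
    simp only [wMeas_eq_withDensity]
    rw [← measure_biUnion_finset (hdisj.subset fun Q hQ => hsub Q hQ)
      fun Q hQ => (hE Q (hsub Q hQ)).1]
    refine le_trans ?_ (hB _ T' (fun Q hQ => hT Q (hsub Q hQ)) R hR (ENNReal.ofReal t) ?_)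
    · gcongr with Q hQ
      exact (hE Q (hsub Q hQ)).2.1
    · intro Q hQ
      have hQ0 := hT Q (hsub Q hQ)
      have h1 : t < (a R Q).toReal := (lt_min_iff.1 (Finset.mem_filter.1 hQ).2).1
      rw [← ENNReal.ofReal_lt_iff_lt_toReal ht.le (hat R Q (hsub Q hQ))] at h1
      rw [← wMeas_eq_withDensity, ← wMeas_eq_withDensity]
      exact (ENNReal.le_div_iff_mul_le
        (Or.inl (hω.wMeas_cube_ne_zero _ (by positivity)))
        (Or.inl (hω.wMeas_cube_ne_top _ (by positivity)))).1 h1.le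
  have hmain := sum_rpow_mul_le_of_weak_bound T (fun Q => wMeas ω (E Q)) hp
    (a := fun Q => min (a P Q).toReal 1) (b := fun Q => min (a G Q).toReal 1)
    (fun Q => le_min ENNReal.toReal_nonneg zero_le_one)
    (fun Q => le_min ENNReal.toReal_nonneg zero_le_one) (fun Q => min_le_right _ _)
    (B * wMeas ω P) (B * wMeas ω G) (hweak P hP) (hweak G hG)
  have hconv : ∀ R, ∀ Q ∈ T, min (a R Q).toReal 1 = (a R Q).toReal := fun R Q hQ =>
    min_eq_left (ENNReal.toReal_le_of_le_ofReal zero_le_one (by simpa using ha1 R Q hQ))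
  have hmain' : ∑ Q ∈ T, a P Q ^ (1 / p) * a G Q * wMeas ω (E Q) ≤
      ENNReal.ofReal (p / (p - 1)) * ENNReal.ofReal p * (B * wMeas ω P) ^ (1 / p) *
        (B * wMeas ω G) ^ (1 - 1 / p) := by
    refine le_trans (le_of_eq (Finset.sum_congr rfl fun Q hQ => ?_)) hmain
    simp only [hconv _ Q hQ]
    rw [ENNReal.toReal_rpow, ENNReal.ofReal_toReal (hat G Q hQ), ENNReal.ofReal_toReal
      (ENNReal.rpow_ne_top_of_nonneg (by positivity) (hat P Q hQ))]
  have hBB : (B : ℝ≥0∞) ^ (1 / p) * (B : ℝ≥0∞) ^ (1 - 1 / p) = ENNReal.ofReal B := by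
    rw [← ENNReal.rpow_add_of_nonneg _ _ (by positivity) hexp, add_sub_cancel, ENNReal.rpow_one,
      ENNReal.ofReal_natCast]
  have hc := sparseTermConst_pos n θ hp hη
  calc _ ≤ ∑ Q ∈ T, ENNReal.ofReal (sparseTermConst n p θ η) *
        ApqR ρ θ 0 p p ω ω ^ (p + 1) * (a P Q ^ (1 / p) * a G Q * wMeas ω (E Q)) :=
        Finset.sum_le_sum fun Q hQ => sparse_term_le hρ hp hθ hη hN hω Q.1 (hT Q hQ) hP
          (hE Q hQ).1 (hE Q hQ).2.1 (hE Q hQ).2.2 G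
    _ ≤ ENNReal.ofReal (sparseTermConst n p θ η) * ApqR ρ θ 0 p p ω ω ^ (p + 1) *
        (ENNReal.ofReal (p / (p - 1)) * ENNReal.ofReal p * (B * wMeas ω P) ^ (1 / p) *
        (B * wMeas ω G) ^ (1 - 1 / p)) := by
        rw [← Finset.mul_sum]
        gcongr
    _ = _ := by
        rw [ENNReal.mul_rpow_of_nonneg _ _ (by positivity), ENNReal.mul_rpow_of_nonneg _ _ hexp,
          ENNReal.ofReal_mul (by positivity), ENNReal.ofReal_mul hc.le, ← hBB]
        ring

theorem measurable_sparseOp {n : ℕ} (ρ : Rn n → ℝ) (N : ℝ) {S : Set (Rn n × ℝ)}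
    (hS : S.Countable) (hS0 : ∀ Q ∈ S, 0 < Q.2) (f : Rn n → ℝ) :
    Measurable (sparseOp ρ N S f) := by
  have := hS.to_subtype
  exact Measurable.tsum fun Q : S =>
    measurable_const.indicator (measurableSet_cube _ (hS0 Q Q.2).le)

/-- Duality form of the restricted weak type bound for sparse operators. -/
theorem exists_setLIntegral_sparseOp_le (n : ℕ) {p θ η : ℝ} (hp : 1 < p) (hθ : 0 ≤ θ)
    (hη : 0 < η) :
    ∃ B : ℕ, ∀ ρ : Rn n → ℝ, (∀ x, 0 < ρ x) → ∀ S : Set (Rn n × ℝ), IsSparse η S →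
    ∀ ω : Rn n → ℝ, IsWeight ω → ∀ N : ℝ, (p + 1) * θ ≤ N →
    ∀ f : Rn n → ℝ, Measurable f → ∀ G : Set (Rn n), MeasurableSet G →
      ∫⁻ x in G, sparseOp ρ N S f x ∂(volume.withDensity fun x => ENNReal.ofReal (ω x)) ≤
      ENNReal.ofReal (sparseTermConst n p θ η * (p / (p - 1)) * B) *
        ApqR ρ θ 0 p p ω ω ^ (p + 1) * lorentzP1 p ω f * wMeas ω G ^ (1 - 1 / p) := by
  obtain ⟨B, hB⟩ := exists_sum_sparse_term_le n hp hθ hη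
  refine ⟨B, fun ρ hρ S hS ω hω N hN f hf G hG => ?_⟩
  obtain ⟨hScount, hS0, E, hE, hdisj⟩ := hS
  have := hScount.to_subtype
  have hlevel : ∀ y : ℝ, MeasurableSet {x | y < |f x|} := fun y =>
    measurableSet_lt measurable_const hf.abs
  have hanti : ∀ μ : Measure (Rn n), Measurable fun y : ℝ => μ {x | y < |f x|} := fun μ =>
    Antitone.measurable fun y z hyz => measure_mono fun x hx => lt_of_le_of_lt hyz hx
  let term : ℝ → Rn n × ℝ → ℝ≥0∞ := fun y Q =>
    (ENNReal.ofReal ((3 * Q.2) ^ n))⁻¹ * volume ({x | y < |f x|} ∩ cube Q.1 (3 * Q.2)) *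
      (ENNReal.ofReal (psi ρ N Q.1 Q.2))⁻¹ * wMeas ω (G ∩ cube Q.1 Q.2)
  have hmeas : ∀ Q : Rn n × ℝ,
      Measurable fun y : ℝ => volume ({x | y < |f x|} ∩ cube Q.1 (3 * Q.2)) := fun Q =>
    Antitone.measurable fun y z hyz => measure_mono
      (inter_subset_inter_left _ fun x hx => lt_of_le_of_lt hyz hx)
  have hterm : ∀ Q, Measurable fun y => term y Q := fun Q =>
    (((hmeas Q).const_mul _).mul_const _).mul_const _
  have hswap : ∫⁻ x in G, sparseOp ρ N S f x
      ∂(volume.withDensity fun x => ENNReal.ofReal (ω x)) =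
      ∑' Q : S, ∫⁻ y in Ioi (0 : ℝ), term y Q := by
    unfold sparseOp
    rw [lintegral_tsum fun Q : S =>
      (measurable_const.indicator (measurableSet_cube _ (hS0 Q Q.2).le)).aemeasurable]
    refine tsum_congr fun Q => ?_
    have hQ0 := hS0 Q Q.2
    rw [lintegral_indicator_const (measurableSet_cube _ hQ0.le),
      Measure.restrict_apply (measurableSet_cube _ hQ0.le), inter_comm,
      ← wMeas_eq_withDensity, lintegral_eq_lintegral_meas_lt _
        (Filter.Eventually.of_forall fun x => abs_nonneg (f x)) hf.abs.aemeasurable,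
      lintegral_mul_const _ (((hmeas Q).const_mul _).mul_const _),
      lintegral_mul_const _ ((hmeas Q).const_mul _), lintegral_const_mul _ (hmeas Q)]
    simp only [Measure.restrict_apply (hlevel _)]
  rw [hswap, ENNReal.tsum_eq_iSup_sum]
  refine iSup_le fun T => ?_
  set D := ENNReal.ofReal (sparseTermConst n p θ η * (p / (p - 1)) * B) *
        ApqR ρ θ 0 p p ω ω ^ (p + 1)
  set T' : Finset (Rn n × ℝ) := T.map (Function.Embedding.subtype _)
  have hT' : ∀ Q ∈ T', Q ∈ S := fun Q hQ => by
    obtain ⟨Q', -, rfl⟩ := Finset.mem_map.1 hQ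
    exact Q'.2
  calc ∑ Q ∈ T, ∫⁻ y in Ioi (0 : ℝ), term y Q = ∫⁻ y in Ioi (0 : ℝ), ∑ Q ∈ T', term y Q := by
        rw [lintegral_finsetSum _ fun Q _ => hterm Q, Finset.sum_map]
        rfl
    _ ≤ ∫⁻ y in Ioi (0 : ℝ), D * ENNReal.ofReal p *
          (wMeas ω {x | y < |f x|} ^ (1 / p) * wMeas ω G ^ (1 - 1 / p)) :=
        lintegral_mono fun y => hB ρ hρ T' (fun Q hQ => hS0 Q (hT' Q hQ)) E
          (fun Q hQ => hE Q (hT' Q hQ)) (hdisj.subset fun Q hQ => hT' Q hQ) ω hω N hN _ G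
          (hlevel y) hG
    _ = D * lorentzP1 p ω f * wMeas ω G ^ (1 - 1 / p) := by
        have h1 : Measurable fun y : ℝ => wMeas ω {x | y < |f x|} ^ (1 / p) := by
          simp only [wMeas_eq_withDensity]
          exact (hanti _).pow_const _
        rw [lintegral_const_mul _ (h1.mul_const _), lintegral_mul_const _ h1, lorentzP1]
        ring

/-- Quantitative restricted weak type bound for the sparse operator
`A_S^{ρ,N}` with `ω ∈ A_p^{ρ,θ,R}` and `N ≥ (p+1)θ`, with a constant depending only on
`n`, `p`, `θ` and `η`. -/
theorem statement7 (n : ℕ) (p θ η : ℝ) (hp : 1 < p) (hθ : 0 ≤ θ)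
    (hη0 : 0 < η) (hη1 : η < 1) :
    ∃ C : ℝ, 0 < C ∧
      ∀ (ρ : Rn n → ℝ), IsCriticalRadius ρ →
      ∀ S : Set (Rn n × ℝ), IsSparse η S →
      ∀ ω : Rn n → ℝ, IsWeight ω → ApqR ρ θ 0 p p ω ω ≠ ∞ →
      ∀ N : ℝ, (p + 1) * θ ≤ N →
      ∀ f : Rn n → ℝ, Measurable f →
        weakNormE p ω (sparseOp ρ N S f) ≤
          ENNReal.ofReal C * (ApqR ρ θ 0 p p ω ω) ^ (p + 1) * lorentzP1 p ω f := by
  obtain ⟨B, hB⟩ := exists_setLIntegral_sparseOp_le n hp hθ hη0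
  have hp0 : 0 < p := by linarith
  have hp1 : 0 < p - 1 := by linarith
  have hexp : 0 < 1 - 1 / p := by
    rw [sub_pos, div_lt_one hp0]; exact hp
  have hc := sparseTermConst_pos n θ hp hη0
  refine ⟨sparseTermConst n p θ η * (p / (p - 1)) * B + 1, by positivity, ?_⟩
  rintro ρ ⟨C₀, N₀, -, -, hρ, -⟩ S hS ω hω - N hN f hf
  set D := ENNReal.ofReal (sparseTermConst n p θ η * (p / (p - 1)) * B) *
    ApqR ρ θ 0 p p ω ω ^ (p + 1) * lorentzP1 p ω f with hD
  suffices weakNormE p ω (sparseOp ρ N S f) ≤ D by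
    refine this.trans ?_
    rw [hD]
    gcongr
    linarith
  refine iSup₂_le fun l hl => ?_
  have hl0 : ENNReal.ofReal l ≠ 0 := by simpa using hl
  set U := {x | ENNReal.ofReal l < sparseOp ρ N S f x} with hU
  have hUm : MeasurableSet U :=
    measurableSet_lt measurable_const (measurable_sparseOp ρ N hS.1 hS.2.1 f)
  have hlocal : ∀ G ⊆ U, MeasurableSet G → wMeas ω G ≠ ∞ →
      wMeas ω G ≤ (D / ENNReal.ofReal l) ^ p := by
    intro G hGU hG hGt
    by_cases hG0 : wMeas ω G = 0
    · rw [hG0]; exact bot_le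
    have h1 : ENNReal.ofReal l * wMeas ω G ≤ D * wMeas ω G ^ (1 - 1 / p) := by
      refine le_trans ?_ (hB ρ hρ S hS ω hω N hN f hf G hG)
      rw [wMeas_eq_withDensity, ← setLIntegral_const]
      exact setLIntegral_mono' hG fun x hx => (hGU hx).le
    have h2 : ENNReal.ofReal l * wMeas ω G =
        ENNReal.ofReal l * wMeas ω G ^ (1 / p) * wMeas ω G ^ (1 - 1 / p) := by
      rw [mul_assoc, ← ENNReal.rpow_add _ _ hG0 hGt, add_sub_cancel, ENNReal.rpow_one]
    rw [h2, ENNReal.mul_le_mul_iff_left (by simp [ENNReal.rpow_eq_zero_iff, hG0, hGt])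
      (ENNReal.rpow_ne_top_of_nonneg hexp.le hGt), mul_comm,
      ← ENNReal.le_div_iff_mul_le (Or.inl hl0) (Or.inl ENNReal.ofReal_ne_top),
      one_div, ENNReal.rpow_inv_le_iff hp0] at h1
    exact h1
  have hUle : wMeas ω U ≤ (D / ENNReal.ofReal l) ^ p := by
    have hcover : U = ⋃ k : ℕ, U ∩ cube 0 k := by
      rw [← inter_iUnion, eq_comm, inter_eq_left]
      intro x _
      obtain ⟨k, hk⟩ := exists_nat_ge (2 * ‖x‖)
      refine mem_iUnion.2 ⟨k, fun i => ?_⟩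
      have h1 := PiLp.norm_apply_le x i
      rw [Real.norm_eq_abs] at h1
      simp only [PiLp.zero_apply, sub_zero]
      linarith
    have hmono : Monotone fun k : ℕ => U ∩ cube (0 : Rn n) k := fun j k hjk =>
      inter_subset_inter_right _ (cube_mono _ (by exact_mod_cast hjk))
    rw [hcover, wMeas_eq_withDensity, hmono.measure_iUnion]
    refine iSup_le fun k => ?_
    rw [← wMeas_eq_withDensity]
    refine hlocal _ inter_subset_left (hUm.inter (measurableSet_cube _ k.cast_nonneg)) ?_
    refine ne_top_of_le_ne_top (hω.wMeas_cube_ne_top 0 (r := k) k.cast_nonneg) ?_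
    rw [wMeas_eq_withDensity, wMeas_eq_withDensity]
    exact measure_mono inter_subset_right
  rwa [← ENNReal.rpow_inv_le_iff hp0, ← one_div,
    ENNReal.le_div_iff_mul_le (Or.inl hl0) (Or.inl ENNReal.ofReal_ne_top), mul_comm] at hUle
end
end
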